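/- Let R be a reduced ring. Then Δ(R[x]) = Δ(R); that is, a polynomial f ∈ R[x] belongs to Δ(R[x]) if and only if f is a constant polynomial f = C(r) for some r ∈ Δ(R). -/

import Mathlib

/-- `Δ(R) = {r ∈ R : r + u is a unit for every unit u of R}`. -/
def Delta (R : Type*) [Ring R] : Set R := {r : R | ∀ u : Rˣ, IsUnit (r + (u : R))}

theorem reduced_mul_swap {R : Type*} [Ring R] [IsReduced R] {a b : R} (h : a * b = 0) :
    b * a = 0 := by
  apply IsReduced.eq_zero
  refine ⟨2, ?_⟩
  rw [pow_two, mul_assoc, ← mul_assoc a, h]; simp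

theorem reduced_mul_mid {R : Type*} [Ring R] [IsReduced R] {a b : R} (h : a * b = 0) (r : R) :
    a * (r * b) = 0 := by
  have h1 : (r * b) * a = 0 := by rw [mul_assoc, reduced_mul_swap h, mul_zero]
  exact reduced_mul_swap h1

theorem reduced_mul_self {R : Type*} [Ring R] [IsReduced R] {a b : R} (h : a * (a * b) = 0) :
    a * b = 0 := by
  have h1 := reduced_mul_mid h b
  have h2 := reduced_mul_swap h
  apply IsReduced.eq_zero
  refine ⟨2, ?_⟩
  rw [pow_two, ← mul_assoc, h2, zero_mul]

theorem reduced_unit_natDegree {R : Type*} [Ring R] [IsReduced R] {f g : Polynomial R}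
    (h : f * g = 1) (h' : g * f = 1) : f.natDegree = 0 := by
  by_contra hn
  have key : ∀ m j : ℕ, g.natDegree < j + m → f.leadingCoeff * g.coeff j = 0 := by
    intro m
    induction m with
    | zero =>
      intro j hj
      rw [Polynomial.coeff_eq_zero_of_natDegree_lt (by omega), mul_zero]
    | succ m ih =>
      intro j hj
      have hc : (f * g).coeff (f.natDegree + j) = 0 := by
        rw [h, Polynomial.coeff_one, if_neg (by omega)]
      rw [Polynomial.coeff_mul] at hc
      apply reduced_mul_self
      have hs := congrArg (fun t => f.leadingCoeff * t) hc
      simp only [mul_zero, Finset.mul_sum] at hs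
      rw [Finset.sum_eq_single (f.natDegree, j)] at hs
      · exact hs
      · rintro ⟨p, q⟩ hp hne
        rw [Finset.HasAntidiagonal.mem_antidiagonal] at hp
        dsimp only at hp ⊢
        rcases lt_trichotomy p f.natDegree with hl | hl | hl
        · exact reduced_mul_mid (ih q (by omega)) _
        · exact absurd (Prod.ext hl (by dsimp only; omega)) hne
        · rw [Polynomial.coeff_eq_zero_of_natDegree_lt hl, zero_mul, mul_zero]
      · intro hx
        exact (hx (by rw [Finset.HasAntidiagonal.mem_antidiagonal])).elim
  have hz : Polynomial.C f.leadingCoeff * g = 0 := by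
    ext j
    rw [Polynomial.coeff_C_mul, Polynomial.coeff_zero]
    exact key (g.natDegree + 1) j (by omega)
  have : Polynomial.C f.leadingCoeff = 0 := by
    rw [← mul_one (Polynomial.C f.leadingCoeff), ← h', ← mul_assoc, hz, zero_mul]
  rw [Polynomial.C_eq_zero, Polynomial.leadingCoeff_eq_zero] at this
  exact hn (by simp [this])

theorem reduced_isUnit_iff {R : Type*} [Ring R] [IsReduced R] {f : Polynomial R} :
    IsUnit f ↔ ∃ r : R, IsUnit r ∧ f = Polynomial.C r := by
  constructor
  · intro hf
    obtain ⟨u, rfl⟩ := hf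
    have hd := Polynomial.eq_C_of_natDegree_eq_zero (reduced_unit_natDegree u.mul_inv u.inv_mul)
    refine ⟨_, ?_, hd⟩
    have := u.isUnit
    rw [hd] at this
    exact Polynomial.isUnit_C.1 this
  · rintro ⟨r, hr, rfl⟩
    exact Polynomial.isUnit_C.2 hr

theorem delta_polynomial_of_reduced (R : Type*) [Ring R] [IsReduced R] (f : Polynomial R) :
    f ∈ Delta (Polynomial R) ↔ ∃ r ∈ Delta R, f = Polynomial.C r := by
  constructor
  · intro hf
    obtain ⟨s, -, hs⟩ := reduced_isUnit_iff.1 (hf 1)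
    have hfs : f = Polynomial.C (s - 1) := by
      rw [Polynomial.C_sub, ← hs]; simp
    refine ⟨s - 1, ?_, hfs⟩
    intro u
    have := hf (Units.map (Polynomial.C : R →+* Polynomial R).toMonoidHom u)
    rw [hfs] at this
    apply Polynomial.isUnit_C.1
    rw [Polynomial.C_add]
    exact this
  · rintro ⟨r, hr, rfl⟩ u
    obtain ⟨s, ⟨v, rfl⟩, hs⟩ := reduced_isUnit_iff.1 u.isUnit
    rw [hs, ← Polynomial.C_add]
    exact Polynomial.isUnit_C.2 (hr v)
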